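/- Let σ be the surface measure on the unit sphere S² ⊂ ℝ³. For a real symmetric traceless 3×3 matrix Q define f(Q) = inf { ∫_{S²} ρ(p) ln ρ(p) dσ(p) : ρ : S² → ℝ measurable, ρ ≥ 0 a.e., ρ(p) = ρ(−p) for a.e. p, ∫_{S²} ρ dσ = 1, ∫_{S²} (p⊗p − (1/3)I) ρ(p) dσ(p) = Q }. Then f is strictly convex on the convex set D = { Q symmetric, tr Q = 0, λ_min(Q) > −1/3 }: for all Q₁, Q₂ ∈ D with Q₁ ≠ Q₂ and all t ∈ (0,1), f( tQ₁ + (1−t)Q₂ ) < t f(Q₁) + (1−t) f(Q₂). -/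

import Mathlib

open scoped BigOperators
open MeasureTheory Metric

noncomputable section

/-- The surface measure on the unit sphere `S² ⊂ ℝ³`. -/
def sphereMeasure : Measure (sphere (0 : EuclideanSpace ℝ (Fin 3)) 1) :=
  (volume : Measure (EuclideanSpace ℝ (Fin 3))).toSphere

/-- The set of entropies `∫ ρ ln ρ dσ` of head-to-tail symmetric probability densities
`ρ` on `S²` whose Q-tensor `∫ (p⊗p − (1/3)I) ρ dσ` equals `Q`. -/
def admissibleEntropies (Q : Matrix (Fin 3) (Fin 3) ℝ) : Set ℝ :=
  {r | ∃ ρ : sphere (0 : EuclideanSpace ℝ (Fin 3)) 1 → ℝ,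
    Measurable ρ ∧ (∀ᵐ p ∂sphereMeasure, 0 ≤ ρ p) ∧
    (∀ᵐ p ∂sphereMeasure, ρ (-p) = ρ p) ∧
    Integrable ρ sphereMeasure ∧ (∫ p, ρ p ∂sphereMeasure) = 1 ∧
    Integrable (fun p => ρ p * Real.log (ρ p)) sphereMeasure ∧
    (∀ i j, (∫ p, ((p : EuclideanSpace ℝ (Fin 3)) i * (p : EuclideanSpace ℝ (Fin 3)) j -
        (if i = j then (1/3 : ℝ) else 0)) * ρ p ∂sphereMeasure) = Q i j) ∧
    r = ∫ p, ρ p * Real.log (ρ p) ∂sphereMeasure}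

/-- The Ball–Majumdar singular bulk potential `f(Q)`: the minimal entropy `∫ ρ ln ρ dσ`
among admissible densities with Q-tensor `Q`. -/
def singularPotential (Q : Matrix (Fin 3) (Fin 3) ℝ) : ℝ :=
  sInf (admissibleEntropies Q)

lemma mul_log_ge (a m u : ℝ) (ha : 0 ≤ a) (hm : 0 < m) :
    a * Real.log m + a * u + a - m * Real.exp u ≤ a * Real.log a := by
  rcases ha.eq_or_lt with rfl | ha
  · have := mul_pos hm (Real.exp_pos u)
    simp only [zero_mul]; linarith
  · have h := Real.log_le_sub_one_of_pos (div_pos (mul_pos hm (Real.exp_pos u)) ha)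
    rw [Real.log_div (by positivity) ha.ne', Real.log_mul hm.ne' (Real.exp_pos u).ne',
      Real.log_exp] at h
    have h2 := mul_le_mul_of_nonneg_left h ha.le
    have h3 : a * (m * Real.exp u / a - 1) = m * Real.exp u - a := by field_simp
    linarith

/-- A quantitative form of the strict convexity of `x ↦ x log x`, linear in `a` and `b`
apart from the entropy terms. -/
lemma mul_log_convex_gap {a b t u : ℝ} (ha : 0 ≤ a) (hb : 0 ≤ b) (ht : t ∈ Set.Ioo (0 : ℝ) 1)
    (hu : |u| ≤ 1) :
    (t * a + (1 - t) * b) * Real.log (t * a + (1 - t) * b) +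
      t * ((1 - t) * (u * a - u * b) - u ^ 2 * (t * a + (1 - t) * b)) ≤
      t * (a * Real.log a) + (1 - t) * (b * Real.log b) := by
  obtain ⟨ht0, ht1⟩ := ht
  have ht1' : 0 < 1 - t := sub_pos.2 ht1
  have hm0 : 0 ≤ t * a + (1 - t) * b := by positivity
  rcases hm0.eq_or_lt with h0 | h0
  · have hta : t * a = 0 := by linarith [mul_nonneg ht0.le ha, mul_nonneg ht1'.le hb]
    have htb : (1 - t) * b = 0 := by linarith
    obtain rfl : a = 0 := (mul_eq_zero.1 hta).resolve_left ht0.ne'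
    obtain rfl : b = 0 := (mul_eq_zero.1 htb).resolve_left ht1'.ne'
    simp
  · generalize hm : t * a + (1 - t) * b = m at *
    have h1 := mul_log_ge a m u ha h0
    have h2 := mul_log_ge b m 0 hb h0
    rw [Real.exp_zero] at h2
    have h3 := (abs_le.1 (Real.abs_exp_sub_one_sub_id_le hu)).2
    have h4 := mul_le_mul_of_nonneg_left h3 h0.le
    have h5 := mul_le_mul_of_nonneg_left h1 ht0.le
    have h6 := mul_le_mul_of_nonneg_left h2 ht1'.le
    have h7 := mul_le_mul_of_nonneg_left h4 ht0.le
    have hml : m * Real.log m = t * a * Real.log m + (1 - t) * b * Real.log m := by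
      rw [← add_mul, hm]
    have hmu : u * m = t * (u * a) + (1 - t) * (u * b) := by rw [← hm]; ring
    linear_combination h5 + h6 + h7 + hml + t * hmu - hm

instance : IsFiniteMeasure sphereMeasure :=
  inferInstanceAs (IsFiniteMeasure (volume : Measure (EuclideanSpace ℝ (Fin 3))).toSphere)

instance : sphereMeasure.IsOpenPosMeasure :=
  inferInstanceAs (volume : Measure (EuclideanSpace ℝ (Fin 3))).toSphere.IsOpenPosMeasure

lemma bddBelow_admissibleEntropies (Q : Matrix (Fin 3) (Fin 3) ℝ) :
    BddBelow (admissibleEntropies Q) := by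
  refine ⟨∫ _, (-1 : ℝ) ∂sphereMeasure, ?_⟩
  rintro _ ⟨ρ, -, hρ, -, -, -, hent, -, rfl⟩
  refine integral_mono_ae (integrable_const _) hent ?_
  filter_upwards [hρ] with p hp
  have := mul_log_ge (ρ p) 1 0 hp one_pos
  simp only [Real.log_one, Real.exp_zero] at this
  linarith

lemma abs_qTensorKernel_le (p : sphere (0 : EuclideanSpace ℝ (Fin 3)) 1) (i j : Fin 3) :
    |(p : EuclideanSpace ℝ (Fin 3)) i * (p : EuclideanSpace ℝ (Fin 3)) j -
      (if i = j then (1/3 : ℝ) else 0)| ≤ 1 := by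
  have h : ∀ k, |(p : EuclideanSpace ℝ (Fin 3)) k| ≤ 1 := fun k => by
    have := PiLp.norm_apply_le (p : EuclideanSpace ℝ (Fin 3)) k
    rwa [norm_eq_of_mem_sphere p, Real.norm_eq_abs] at this
  have hi := abs_le.1 (h i)
  have hj := abs_le.1 (h j)
  split_ifs with hij
  · subst hij
    rw [abs_le]
    constructor <;> nlinarith [mul_self_nonneg ((p : EuclideanSpace ℝ (Fin 3)) i)]
  · rw [sub_zero, abs_mul]; exact mul_le_one₀ (h i) (abs_nonneg _) (h j)

lemma measurable_qTensorKernel (i j : Fin 3) :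
    Measurable (fun p : sphere (0 : EuclideanSpace ℝ (Fin 3)) 1 =>
      (p : EuclideanSpace ℝ (Fin 3)) i * (p : EuclideanSpace ℝ (Fin 3)) j -
        (if i = j then (1/3 : ℝ) else 0)) := by
  fun_prop

lemma integrable_qTensorKernel_mul {ρ : sphere (0 : EuclideanSpace ℝ (Fin 3)) 1 → ℝ}
    (hρ : Integrable ρ sphereMeasure) (i j : Fin 3) :
    Integrable (fun p : sphere (0 : EuclideanSpace ℝ (Fin 3)) 1 =>
      ((p : EuclideanSpace ℝ (Fin 3)) i * (p : EuclideanSpace ℝ (Fin 3)) j -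
        (if i = j then (1/3 : ℝ) else 0)) * ρ p) sphereMeasure :=
  hρ.bdd_mul (measurable_qTensorKernel i j).aestronglyMeasurable
    (Filter.Eventually.of_forall fun p => abs_qTensorKernel_le p i j)

/-- Mixing two admissible densities lowers the entropy by an amount which depends only on
the weights and on the Q-tensors. -/
lemma exists_mem_admissibleEntropies_add_le {Q₁ Q₂ : Matrix (Fin 3) (Fin 3) ℝ} {r₁ r₂ : ℝ}
    (h₁ : r₁ ∈ admissibleEntropies Q₁) (h₂ : r₂ ∈ admissibleEntropies Q₂)
    {t s : ℝ} (ht : t ∈ Set.Ioo (0 : ℝ) 1) (hs : |s| ≤ 1) (i j : Fin 3) :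
    ∃ r ∈ admissibleEntropies (t • Q₁ + (1 - t) • Q₂),
      r + t * ((1 - t) * (s * (Q₁ i j - Q₂ i j)) - s ^ 2) ≤ t * r₁ + (1 - t) * r₂ := by
  obtain ⟨a, ham, ha0, haev, hai, ha1, hae, haQ, rfl⟩ := h₁
  obtain ⟨b, hbm, hb0, hbev, hbi, hb1, hbe, hbQ, rfl⟩ := h₂
  have ht0 := ht.1
  have ht1 : 0 < 1 - t := sub_pos.2 ht.2
  have hmi : Integrable (fun p => t * a p + (1 - t) * b p) sphereMeasure :=
    (hai.const_mul t).add (hbi.const_mul (1 - t))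
  have hmE : Integrable (fun p => t * (a p * Real.log (a p)) + (1 - t) * (b p * Real.log (b p)))
      sphereMeasure := (hae.const_mul t).add (hbe.const_mul (1 - t))
  have hm1 : ∫ p, (t * a p + (1 - t) * b p) ∂sphereMeasure = 1 := by
    rw [integral_add (hai.const_mul t) (hbi.const_mul (1 - t)), integral_const_mul,
      integral_const_mul, ha1, hb1]
    ring
  have hme : Integrable (fun p => (t * a p + (1 - t) * b p) *
      Real.log (t * a p + (1 - t) * b p)) sphereMeasure := by
    refine integrable_of_le_of_le (g₁ := fun _ => (-1 : ℝ)) (g₂ := fun p =>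
      t * (a p * Real.log (a p)) + (1 - t) * (b p * Real.log (b p)))
      (by fun_prop) ?_ ?_ (integrable_const _) hmE
    · filter_upwards [ha0, hb0] with p hap hbp
      have hp : 0 ≤ t * a p + (1 - t) * b p := by positivity
      have := mul_log_ge _ 1 0 hp one_pos
      simp only [Real.log_one, Real.exp_zero] at this
      linarith
    · filter_upwards [ha0, hb0] with p hap hbp
      simpa using mul_log_convex_gap hap hbp ht (u := 0) (by simp)
  refine ⟨_, ⟨fun p => t * a p + (1 - t) * b p, by fun_prop, ?_, ?_, hmi, hm1, hme, ?_, rfl⟩, ?_⟩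
  · filter_upwards [ha0, hb0] with p hap hbp
    positivity
  · filter_upwards [haev, hbev] with p hap hbp
    rw [hap, hbp]
  · intro k l
    rw [← sub_eq_zero]
    simp only [mul_add, mul_left_comm _ t, mul_left_comm _ (1 - t)]
    rw [integral_add ((integrable_qTensorKernel_mul hai k l).const_mul t)
      ((integrable_qTensorKernel_mul hbi k l).const_mul (1 - t)), integral_const_mul,
      integral_const_mul, haQ, hbQ]
    simp
  · set φ : sphere (0 : EuclideanSpace ℝ (Fin 3)) 1 → ℝ := fun p =>
      (p : EuclideanSpace ℝ (Fin 3)) i * (p : EuclideanSpace ℝ (Fin 3)) j -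
        (if i = j then (1/3 : ℝ) else 0)
    have hφa : Integrable (fun p => φ p * a p) sphereMeasure := integrable_qTensorKernel_mul hai i j
    have hφb : Integrable (fun p => φ p * b p) sphereMeasure := integrable_qTensorKernel_mul hbi i j
    have hdiff : Integrable (fun p => (1 - t) * (s * (φ p * a p - φ p * b p))) sphereMeasure :=
      ((hφa.sub hφb).const_mul s).const_mul (1 - t)
    have hgap : Integrable (fun p => t * ((1 - t) * (s * (φ p * a p - φ p * b p)) -
        s ^ 2 * (t * a p + (1 - t) * b p))) sphereMeasure :=
      (hdiff.sub (hmi.const_mul (s ^ 2))).const_mul t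
    have hgapint : ∫ p, t * ((1 - t) * (s * (φ p * a p - φ p * b p)) -
        s ^ 2 * (t * a p + (1 - t) * b p)) ∂sphereMeasure =
        t * ((1 - t) * (s * (Q₁ i j - Q₂ i j)) - s ^ 2) := by
      rw [integral_const_mul, integral_sub hdiff (hmi.const_mul (s ^ 2)), integral_const_mul,
        integral_const_mul, integral_const_mul,
        integral_sub hφa hφb, hm1, haQ, hbQ, mul_one]
    rw [← hgapint, ← integral_const_mul, ← integral_const_mul, ← integral_add hme hgap,
      ← integral_add (hae.const_mul t) (hbe.const_mul (1 - t))]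
    refine integral_mono_ae (hme.add hgap) hmE ?_
    filter_upwards [ha0, hb0] with p hap hbp
    have hφp : |φ p| ≤ 1 := abs_qTensorKernel_le p i j
    have hu : |s * φ p| ≤ 1 := by
      rw [abs_mul]; exact mul_le_one₀ hs (abs_nonneg _) hφp
    have hmp : 0 ≤ t * a p + (1 - t) * b p := by positivity
    have h := mul_log_convex_gap hap hbp ht hu
    have hsq : (s * φ p) ^ 2 ≤ s ^ 2 := by
      rw [mul_pow]
      exact mul_le_of_le_one_right (sq_nonneg s) ((sq_le_one_iff_abs_le_one _).2 hφp)
    have h2 := mul_le_mul_of_nonneg_left (mul_le_mul_of_nonneg_right hsq hmp) ht0.le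
    linarith

local notation "E₃" => EuclideanSpace ℝ (Fin 3)

lemma integral_eq_integral_sphere_Ioi {f : E₃ → ℝ} (hf : Integrable f) :
    ∫ x, f x = ∫ p, (∫ r in Set.Ioi (0 : ℝ), r ^ 2 * f (r • (p : E₃))) ∂sphereMeasure := by
  have hmp := (volume : Measure E₃).measurePreserving_homeomorphUnitSphereProd
  have hemb := (homeomorphUnitSphereProd E₃).measurableEmbedding
  rw [show Module.finrank ℝ E₃ - 1 = 2 by simp] at hmp
  set g : sphere (0 : E₃) 1 × Set.Ioi (0 : ℝ) → ℝ := fun q => f ((q.2 : ℝ) • (q.1 : E₃)) with hg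
  have hcomp : g ∘ homeomorphUnitSphereProd E₃ = fun x : ({0}ᶜ : Set E₃) => f x := by
    funext x
    have hx : ‖(x : E₃)‖ ≠ 0 := norm_ne_zero_iff.2 x.2
    simp [hg, smul_smul, mul_inv_cancel₀ hx]
  have hint : Integrable g (sphereMeasure.prod (Measure.volumeIoiPow 2)) := by
    rw [sphereMeasure, ← hmp.integrable_comp_emb hemb, hcomp]
    have := hf.integrableOn (s := ({0}ᶜ : Set E₃))
    rwa [integrableOn_iff_comap_subtypeVal (by measurability)] at this
  calc ∫ x, f x = ∫ x : ({0}ᶜ : Set E₃), f x ∂((volume : Measure E₃).comap Subtype.val) := by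
        rw [integral_subtype_comap (measurableSet_singleton _).compl f,
          restrict_compl_singleton]
    _ = ∫ q, g q ∂(sphereMeasure.prod (Measure.volumeIoiPow 2)) := by
        rw [sphereMeasure, ← hmp.integral_comp hemb]
        exact congrArg (fun h : ({0}ᶜ : Set E₃) → ℝ =>
          ∫ x, h x ∂((volume : Measure E₃).comap Subtype.val)) hcomp.symm
    _ = _ := by
        rw [integral_prod _ hint]
        congr 1
        funext p
        simp only [Measure.volumeIoiPow, ENNReal.ofReal, hg]
        rw [integral_withDensity_eq_integral_smul
          (measurable_subtype_coe.pow_const _).real_toNNReal,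
          integral_subtype_comap measurableSet_Ioi
            fun a => Real.toNNReal (a ^ 2) • f (a • (p : E₃)),
          setIntegral_congr_fun measurableSet_Ioi fun x hx => ?_]
        rw [NNReal.smul_def, Real.coe_toNNReal _ (pow_nonneg hx.out.le _), smul_eq_mul]

lemma setIntegral_closedBall_comp (e : E₃ ≃ₗᵢ[ℝ] E₃) (f : E₃ → ℝ) :
    ∫ y in closedBall (0 : E₃) 1, f (e y) = ∫ y in closedBall (0 : E₃) 1, f y := by
  have h := e.measurePreserving.setIntegral_preimage_emb
    e.toHomeomorph.measurableEmbedding f (closedBall (0 : E₃) 1)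
  rwa [e.preimage_closedBall, map_zero] at h

lemma exists_setIntegral_closedBall_mul_eq :
    ∃ κ : ℝ, ∀ i j : Fin 3,
      ∫ y in closedBall (0 : E₃) 1, y i * y j = if i = j then κ else 0 := by
  refine ⟨∫ y in closedBall (0 : E₃) 1, y 0 * y 0, fun i j => ?_⟩
  split_ifs with hij
  · subst hij
    simpa [LinearIsometryEquiv.piLpCongrLeft_apply, Equiv.piCongrLeft'] using
      setIntegral_closedBall_comp
      (LinearIsometryEquiv.piLpCongrLeft 2 ℝ ℝ (Equiv.swap 0 i)) (fun y => y 0 * y 0)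
  · have h := setIntegral_closedBall_comp
      (LinearIsometryEquiv.piLpCongrRight 2 fun k : Fin 3 =>
        if k = i then LinearIsometryEquiv.neg ℝ else LinearIsometryEquiv.refl ℝ ℝ)
      (fun y => y i * y j)
    simp only [LinearIsometryEquiv.piLpCongrRight_apply, if_pos, if_neg (Ne.symm hij),
      LinearIsometryEquiv.coe_neg, LinearIsometryEquiv.coe_refl, id_eq, neg_mul,
      integral_neg] at h
    linarith

lemma exists_integral_comp_symm (L : E₃ ≃L[ℝ] E₃) :
    ∃ c : ℝ, ∀ f : E₃ → ℝ, ∫ x, f (L.symm x) = c * ∫ y, f y := by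
  have hdet : LinearMap.det (L.symm.toLinearEquiv : E₃ →ₗ[ℝ] E₃) ≠ 0 :=
    (LinearEquiv.isUnit_det' L.symm.toLinearEquiv).ne_zero
  refine ⟨|(LinearMap.det (L.symm.toLinearEquiv : E₃ →ₗ[ℝ] E₃))⁻¹|, fun f => ?_⟩
  have h := Measure.map_linearMap_addHaar_eq_smul_addHaar (volume : Measure E₃) hdet
  have h2 := L.symm.toHomeomorph.measurableEmbedding.integral_map (μ := volume) f
  change ∫ y, f y ∂(Measure.map (L.symm.toLinearEquiv : E₃ →ₗ[ℝ] E₃) volume) =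
    ∫ x, f (L.symm x) at h2
  rw [← h2, h, integral_smul_measure, ENNReal.toReal_ofReal (abs_nonneg _), smul_eq_mul]

/-- The radial projection of the measure `‖x‖² dx` on the ellipsoid `L (closedBall 0 1)` has
second moments proportional to `L Lᵀ`. -/
lemma exists_integral_mul_norm_symm_inv_pow (L : E₃ ≃L[ℝ] E₃) :
    ∃ C : ℝ, ∀ i j : Fin 3,
      ∫ p, (p : E₃) i * (p : E₃) j * (‖L.symm p‖⁻¹ ^ 5) ∂sphereMeasure =
        C * ∑ k, L (EuclideanSpace.single k 1) i * L (EuclideanSpace.single k 1) j := by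
  obtain ⟨κ, hκ⟩ := exists_setIntegral_closedBall_mul_eq
  obtain ⟨c, hc⟩ := exists_integral_comp_symm L
  refine ⟨5 * (c * κ), fun i j => ?_⟩
  have hLsum : ∀ (y : E₃) (i : Fin 3), L y i = ∑ k, y k * L (EuclideanSpace.single k 1) i := by
    intro y i
    conv_lhs => rw [← (EuclideanSpace.basisFun (Fin 3) ℝ).sum_repr y]
    simp
  set f : E₃ → ℝ := (closedBall (0 : E₃) 1).indicator fun y => L y i * L y j with hf
  have hball : ∫ y, f y = κ * ∑ k, L (EuclideanSpace.single k 1) i *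
      L (EuclideanSpace.single k 1) j := by
    rw [hf, integral_indicator measurableSet_closedBall]
    have hprod : (fun y => L y i * L y j) = fun y : E₃ => ∑ k, ∑ l,
        y k * L (EuclideanSpace.single k 1) i * (y l * L (EuclideanSpace.single l 1) j) := by
      funext y
      rw [hLsum y i, hLsum y j, Finset.sum_mul_sum]
    rw [hprod]
    have hI : ∀ k l : Fin 3, IntegrableOn (fun y : E₃ =>
        y k * L (EuclideanSpace.single k 1) i * (y l * L (EuclideanSpace.single l 1) j))
        (closedBall 0 1) := fun k l =>
      ContinuousOn.integrableOn_compact (isCompact_closedBall _ _) (by fun_prop)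
    rw [integral_finsetSum _ fun k _ => integrable_finsetSum _ fun l _ => hI k l,
      Finset.mul_sum]
    refine Finset.sum_congr rfl fun k _ => ?_
    rw [integral_finsetSum _ fun l _ => hI k l]
    have : ∀ l, ∫ y in closedBall (0 : E₃) 1,
        y k * L (EuclideanSpace.single k 1) i * (y l * L (EuclideanSpace.single l 1) j) =
        (if k = l then κ else 0) *
          (L (EuclideanSpace.single k 1) i * L (EuclideanSpace.single l 1) j) := fun l => by
      rw [← hκ, ← integral_mul_const]
      congr 1
      funext y
      ring
    simp [this]
  have hfi : Integrable (fun x => f (L.symm x)) := by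
    have : (fun x => f (L.symm x)) =
        (L.symm ⁻¹' closedBall (0 : E₃) 1).indicator fun x => x i * x j := by
      funext x
      simp [hf, Set.indicator]
    rw [this, integrable_indicator_iff
      (L.symm.continuous.measurable measurableSet_closedBall)]
    refine ContinuousOn.integrableOn_compact ?_ (by fun_prop)
    exact L.symm.toHomeomorph.isCompact_preimage.2 (isCompact_closedBall _ _)
  have hpolar := integral_eq_integral_sphere_Ioi hfi
  rw [hc, hball] at hpolar
  rw [mul_assoc, mul_assoc, hpolar, ← integral_const_mul]
  congr 1
  funext p
  have hp : 0 < ‖L.symm p‖ := by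
    rw [norm_pos_iff, ne_eq, L.symm.map_eq_zero_iff]
    exact ne_zero_of_mem_unit_sphere p
  have hN : 0 < ‖L.symm p‖⁻¹ := inv_pos.2 hp
  have hinner : ∫ r in Set.Ioi (0 : ℝ), r ^ 2 * f (L.symm (r • (p : E₃))) =
      ∫ r in Set.Ioi (0 : ℝ), (Set.Iic ‖L.symm p‖⁻¹).indicator
        (fun r => r ^ 4 * ((p : E₃) i * (p : E₃) j)) r := by
    refine setIntegral_congr_fun measurableSet_Ioi fun r hr => ?_
    have hr' : (0 : ℝ) < r := hr
    have hmem : r • L.symm (p : E₃) ∈ closedBall (0 : E₃) 1 ↔ r ∈ Set.Iic ‖L.symm p‖⁻¹ := by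
      rw [mem_closedBall_zero_iff, norm_smul, Real.norm_of_nonneg hr'.le, Set.mem_Iic,
        ← one_div, le_div_iff₀ hp]
    by_cases h : r ∈ Set.Iic ‖L.symm p‖⁻¹
    · rw [map_smul, hf, Set.indicator_of_mem (hmem.2 h), Set.indicator_of_mem h]
      simp
      ring
    · rw [map_smul, hf, Set.indicator_of_notMem (mt hmem.1 h), Set.indicator_of_notMem h,
        mul_zero]
  rw [hinner, setIntegral_indicator measurableSet_Iic, Set.Ioi_inter_Iic,
    ← intervalIntegral.integral_of_le hN.le, intervalIntegral.integral_mul_const, integral_pow]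
  norm_num
  ring

/-- The density is `p ↦ (pᵀ M⁻¹ p) ^ (-5/2)`, normalized, where `M = Q + (1/3) I`. -/
lemma nonempty_admissibleEntropies {Q : Matrix (Fin 3) (Fin 3) ℝ} (hQ : Q.IsHermitian)
    (htr : Q.trace = 0) (hmin : ∀ i, -(1/3 : ℝ) < hQ.eigenvalues i) :
    (admissibleEntropies Q).Nonempty := by
  have hpos : ∀ k, 0 < hQ.eigenvalues k + 1 / 3 := fun k => by linarith [hmin k]
  let v := hQ.eigenvectorBasis
  let b : Module.Basis (Fin 3) ℝ E₃ := v.toBasis.isUnitSMul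
    (w := fun k => √(hQ.eigenvalues k + 1 / 3))
    fun k => (Real.sqrt_pos.2 (hpos k)).ne'.isUnit
  let L : E₃ ≃L[ℝ] E₃ :=
    ((EuclideanSpace.basisFun (Fin 3) ℝ).toBasis.equiv b (Equiv.refl _)).toContinuousLinearEquiv
  have hL : ∀ k, L (EuclideanSpace.single k 1) = √(hQ.eigenvalues k + 1 / 3) • v k := fun k => by
    have h := (EuclideanSpace.basisFun (Fin 3) ℝ).toBasis.equiv_apply k b (Equiv.refl _)
    simpa [L, b, Module.Basis.isUnitSMul_apply] using h
  have hspec : ∀ i j, ∑ k, hQ.eigenvalues k * (v k i * v k j) = Q i j := fun i j => by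
    conv_rhs => rw [hQ.spectral_theorem]
    simp [Unitary.conjStarAlgAut_apply, Matrix.mul_apply, Matrix.diagonal_apply, v,
      Matrix.star_apply]
    refine Finset.sum_congr rfl fun k _ => ?_
    ring
  have horth : ∀ i j, ∑ k, v k i * v k j = if i = j then 1 else 0 := fun i j => by
    have h := congrFun (congrFun (Unitary.coe_mul_star_self hQ.eigenvectorUnitary) i) j
    simpa [Matrix.mul_apply, Matrix.star_apply, v, Matrix.one_apply] using h
  have hLL : ∀ i j, ∑ k, L (EuclideanSpace.single k 1) i * L (EuclideanSpace.single k 1) j =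
      Q i j + if i = j then 1 / 3 else 0 := fun i j => by
    have : ∀ k, L (EuclideanSpace.single k 1) i * L (EuclideanSpace.single k 1) j =
        hQ.eigenvalues k * (v k i * v k j) + 1 / 3 * (v k i * v k j) := fun k => by
      have hs := Real.mul_self_sqrt (hpos k).le
      simp only [hL, PiLp.smul_apply, smul_eq_mul]
      linear_combination (v k i * v k j) * hs
    simp only [this]
    rw [Finset.sum_add_distrib, ← Finset.mul_sum, hspec, horth]
    simp
  obtain ⟨C, hC⟩ := exists_integral_mul_norm_symm_inv_pow L
  simp only [hLL] at hC
  set w : sphere (0 : E₃) 1 → ℝ := fun p => ‖L.symm p‖⁻¹ ^ 5 with hw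
  have hLp : ∀ p : sphere (0 : E₃) 1, 0 < ‖L.symm p‖ := fun p => by
    rw [norm_pos_iff, ne_eq, L.symm.map_eq_zero_iff]
    exact ne_zero_of_mem_unit_sphere p
  have hwpos : ∀ p, 0 < w p := fun p => pow_pos (inv_pos.2 (hLp p)) 5
  have hwc : Continuous w :=
    ((L.symm.continuous.comp continuous_subtype_val).norm.inv₀ fun p => (hLp p).ne').pow 5
  have hint : ∀ {g : sphere (0 : E₃) 1 → ℝ}, Continuous g → Integrable g sphereMeasure :=
    fun hg => hg.integrable_of_hasCompactSupport (HasCompactSupport.of_compactSpace _)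
  have hsum : ∀ p : sphere (0 : E₃) 1, ∑ i, (p : E₃) i * (p : E₃) i = 1 := fun p => by
    have h := EuclideanSpace.real_norm_sq_eq (p : E₃)
    rw [norm_eq_of_mem_sphere p] at h
    simpa [sq] using h.symm
  have hwint : ∫ p, w p ∂sphereMeasure = C := by
    have h1 : ∀ p, w p = ∑ i, (p : E₃) i * (p : E₃) i * w p := fun p => by
      rw [← Finset.sum_mul, hsum, one_mul]
    rw [integral_congr_ae (.of_forall h1), integral_finsetSum _ fun i _ => hint (by fun_prop)]
    simp only [hw, hC]
    rw [← Finset.mul_sum, Finset.sum_add_distrib]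
    rw [Matrix.trace] at htr
    simp only [Matrix.diag] at htr
    rw [htr]
    simp
  have hCpos : 0 < C := by
    rw [← hwint]
    have : Nonempty (sphere (0 : E₃) 1) := (NormedSpace.sphere_nonempty.2 zero_le_one).to_subtype
    exact hwc.integral_pos_of_hasCompactSupport_nonneg_nonzero
      (HasCompactSupport.of_compactSpace _) (fun p => (hwpos p).le)
      (x := Classical.arbitrary _) (hwpos _).ne'
  have hρ : Continuous fun p => w p / C := hwc.div_const C
  refine ⟨_, fun p => w p / C, hρ.measurable, .of_forall fun p => (div_pos (hwpos p) hCpos).le,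
    .of_forall fun p => ?_, hint hρ, ?_,
    hint (hρ.mul (hρ.log fun p => (div_pos (hwpos p) hCpos).ne')),
    fun i j => ?_, rfl⟩
  · simp [hw]
  · rw [integral_div, hwint, div_self hCpos.ne']
  · have h1 : ∀ p : sphere (0 : E₃) 1,
        ((p : E₃) i * (p : E₃) j - (if i = j then (1/3 : ℝ) else 0)) * (w p / C) =
        ((p : E₃) i * (p : E₃) j * w p - (if i = j then (1/3 : ℝ) else 0) * w p) / C :=
      fun p => by ring
    simp_rw [h1]
    rw [integral_div, integral_sub (hint (by fun_prop)) (hint (by fun_prop)),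
      integral_const_mul, hwint, hC]
    field_simp
    ring

/-- Strict convexity of the Ball–Majumdar singular potential on the convex set of
symmetric traceless matrices with `λ_min > −1/3`. -/
theorem singular_potential_strictly_convex
    (Q₁ Q₂ : Matrix (Fin 3) (Fin 3) ℝ)
    (hQ₁ : Q₁.IsHermitian) (hQ₂ : Q₂.IsHermitian)
    (htr₁ : Q₁.trace = 0) (htr₂ : Q₂.trace = 0)
    (hmin₁ : -(1/3 : ℝ) < ⨅ i, hQ₁.eigenvalues i)
    (hmin₂ : -(1/3 : ℝ) < ⨅ i, hQ₂.eigenvalues i)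
    (hne : Q₁ ≠ Q₂) (t : ℝ) (ht : t ∈ Set.Ioo (0 : ℝ) 1) :
    singularPotential (t • Q₁ + (1 - t) • Q₂) <
      t * singularPotential Q₁ + (1 - t) * singularPotential Q₂ := by

  have hmem {Q : Matrix (Fin 3) (Fin 3) ℝ} (hQ : Q.IsHermitian) (htr : Q.trace = 0)
      (hmin : -(1/3 : ℝ) < ⨅ i, hQ.eigenvalues i) : (admissibleEntropies Q).Nonempty :=
    nonempty_admissibleEntropies hQ htr fun i =>
      hmin.trans_le (ciInf_le (Set.finite_range _).bddBelow i)
  have hne₁ := hmem hQ₁ htr₁ hmin₁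
  have hne₂ := hmem hQ₂ htr₂ hmin₂
  obtain ⟨i, j, hij⟩ : ∃ i j, Q₁ i j ≠ Q₂ i j := by
    by_contra! h
    exact hne (Matrix.ext h)
  have ht0 := ht.1
  have ht1 : 0 < 1 - t := sub_pos.2 ht.2
  obtain ⟨s, hs, hgap⟩ : ∃ s : ℝ, |s| ≤ 1 ∧
      0 < t * ((1 - t) * (s * (Q₁ i j - Q₂ i j)) - s ^ 2) := by
    have hd : (1 - t) * (Q₁ i j - Q₂ i j) ≠ 0 := mul_ne_zero ht1.ne' (sub_ne_zero.2 hij)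
    generalize hd' : (1 - t) * (Q₁ i j - Q₂ i j) = d at hd
    refine ⟨d / (2 + d ^ 2), ?_, mul_pos ht0 ?_⟩
    · rw [abs_div, abs_of_pos (show 0 < 2 + d ^ 2 by positivity), div_le_one (by positivity),
        abs_le]
      constructor <;> nlinarith [sq_nonneg (d - 1), sq_nonneg (d + 1)]
    · have : (1 - t) * (d / (2 + d ^ 2) * (Q₁ i j - Q₂ i j)) - (d / (2 + d ^ 2)) ^ 2 =
          d ^ 2 * (1 + d ^ 2) / (2 + d ^ 2) ^ 2 := by
        rw [mul_left_comm, hd']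
        field_simp
        ring
      rw [this]
      positivity
  set g := t * ((1 - t) * (s * (Q₁ i j - Q₂ i j)) - s ^ 2)
  obtain ⟨r₁, hr₁, hlt₁⟩ := exists_lt_of_csInf_lt hne₁
    (show sInf (admissibleEntropies Q₁) < singularPotential Q₁ + g by
      rw [singularPotential]; linarith)
  obtain ⟨r₂, hr₂, hlt₂⟩ := exists_lt_of_csInf_lt hne₂
    (show sInf (admissibleEntropies Q₂) < singularPotential Q₂ + g by
      rw [singularPotential]; linarith)
  obtain ⟨r, hr, hle⟩ := exists_mem_admissibleEntropies_add_le hr₁ hr₂ ht hs i j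
  have hinf : singularPotential (t • Q₁ + (1 - t) • Q₂) ≤ r :=
    csInf_le (bddBelow_admissibleEntropies _) hr
  have h₁ := mul_lt_mul_of_pos_left hlt₁ ht0
  have h₂ := mul_lt_mul_of_pos_left hlt₂ ht1
  linarith
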